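/- arXiv:2506.12271 — 2 statements merged into one kernel-verified Lean document; each statement's English description precedes it below -/
import Mathlib

section
/- Let G be an oriented hypergraph. In the polynomial ring ℤ[x_v, y_e : v∈V, e∈E], the extended characteristic polynomial of G equals that of its incidence dual G*: Σ_{(S,c)} csgn(c) · Π_{v∈S} x_v · Π_{e∈T(c)} y_e = Σ_{(S*,c*)} csgn(c*) · Π_{e∈S*} y_e · Π_{v∈T(c*)} x_v, where the left sum runs over all diagonally reduced contributors (S,c) of G with unused edge set T(c), and the right sum runs over all diagonally reduced contributors (S*,c*) of G* with unused set T(c*) ⊆ V. -/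
open Matrix
open scoped Classical

noncomputable section

/-- An oriented hypergraph `G = (V, E, I, ς, ω, σ)`: `vtx = ς` assigns each incidence
its vertex, `edg = ω` assigns each incidence its edge, and `sgn = σ` is its sign. -/
structure OHG (V E I : Type*) where
  vtx : I → V
  edg : I → E
  sgn : I → ℤˣ

/-- The incidence dual `G* = (E, V, I, ω, ς, σ)`. -/
def OHG.dual {V E I : Type*} (G : OHG V E I) : OHG E V I :=
  ⟨G.edg, G.vtx, G.sgn⟩

section Defs

variable {V E I : Type*} [Fintype V] [DecidableEq V] [Fintype E] [DecidableEq E]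
  [Fintype I] [DecidableEq I]

/-- A diagonally reduced contributor `(S, c)`: `c : V∖S → I × I`, tails sit at their
vertices, tail and head share an edge, the head map is a permutation of `V∖S`, and `c`
is edge-monic. -/
def IsDiagRed (G : OHG V E I) (S : Finset V) (c : {v : V // v ∉ S} → I × I) : Prop :=
  (∀ v, G.vtx (c v).1 = v.1) ∧ (∀ v, G.edg (c v).1 = G.edg (c v).2) ∧
    Set.BijOn (fun v : {v : V // v ∉ S} => G.vtx (c v).2) Set.univ {w : V | w ∉ S} ∧
    Function.Injective fun v : {v : V // v ∉ S} => G.edg (c v).1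

/-- The unused edge set `T = E ∖ {ω (t_v) : v ∈ V∖S}` of a diagonally reduced
contributor. -/
def unusedT (G : OHG V E I) (S : Finset V) (c : {v : V // v ∉ S} → I × I) :
    Finset E :=
  Finset.univ.filter fun e => ∀ v : {v : V // v ∉ S}, G.edg (c v).1 ≠ e

/-- The head map of a diagonally reduced contributor, extended to all of `V` by the
identity on `S`. -/
def gmapD (G : OHG V E I) (S : Finset V) (c : {v : V // v ∉ S} → I × I) : V → V :=
  fun v => if h : v ∈ S then v else G.vtx (c ⟨v, h⟩).2

/-- The orbit of `v` under iteration of `f` (for `f` a bijection of a finite type this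
is the full cycle of `v`). -/
def orbitOf {α : Type*} [Fintype α] [DecidableEq α] (f : α → α) (a : α) : Finset α :=
  Finset.univ.filter fun b => ∃ n : ℕ, f^[n] a = b

/-- The set of orbits of `f`. -/
def orbitsOf {α : Type*} [Fintype α] [DecidableEq α] (f : α → α) :
    Finset (Finset α) :=
  Finset.univ.image (orbitOf f)

/-- `ec c`: the number of orbits of `π_c` of even cardinality. -/
def ecD (G : OHG V E I) (S : Finset V) (c : {v : V // v ∉ S} → I × I) : ℕ :=
  ((orbitsOf (gmapD G S c)).filter fun O => Even O.card).card

/-- `bs c`: the number of backsteps of a diagonally reduced contributor. -/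
def bsD (G : OHG V E I) (S : Finset V) (c : {v : V // v ∉ S} → I × I) : ℕ :=
  (Finset.univ.filter fun v : {v : V // v ∉ S} => (c v).1 = (c v).2).card

/-- A negative orbit: not a single backstep, and the product of the adjacency signs
`-σ(t_v)·σ(h_v)` over the orbit is `-1`. -/
def NegOrbitD (G : OHG V E I) (S : Finset V) (c : {v : V // v ∉ S} → I × I)
    (O : Finset V) : Prop :=
  (¬ ∃ v : {v : V // v ∉ S}, O = {v.1} ∧ (c v).1 = (c v).2) ∧
    ∏ v ∈ Finset.univ.filter (fun v : {v : V // v ∉ S} => v.1 ∈ O),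
      (-(G.sgn (c v).1 * G.sgn (c v).2)) = (-1 : ℤˣ)

/-- `nc c`: the number of negative orbits of a diagonally reduced contributor. -/
def ncD (G : OHG V E I) (S : Finset V) (c : {v : V // v ∉ S} → I × I) : ℕ :=
  ((orbitsOf (gmapD G S c)).filter (NegOrbitD G S c)).card

/-- The sign `csgn c = (-1) ^ (ec c + nc c + bs c)` of a diagonally reduced
contributor. -/
def csgnD (G : OHG V E I) (S : Finset V) (c : {v : V // v ∉ S} → I × I) : ℤ :=
  (-1) ^ (ecD G S c + ncD G S c + bsD G S c)

/-- The incidence matrix of an oriented hypergraph. -/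
def incM (G : OHG V E I) : Matrix V E ℤ :=
  Matrix.of fun v e =>
    ∑ i ∈ Finset.univ.filter (fun i => G.vtx i = v ∧ G.edg i = e), (G.sgn i : ℤ)

/-- The Laplacian `L = H Hᵀ` of an oriented hypergraph. -/
def lapM (G : OHG V E I) : Matrix V V ℤ :=
  incM G * (incM G)ᵀ

end Defs

variable {V E I : Type*} [Fintype V] [DecidableEq V] [Fintype E] [DecidableEq E]
  [Fintype I] [DecidableEq I]

set_option linter.unusedSectionVars false

lemma mem_unusedT {G : OHG V E I} {S : Finset V} {c : {v : V // v ∉ S} → I × I} {e : E} :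
    e ∈ unusedT G S c ↔ ∀ v, G.edg (c v).1 ≠ e := by
  simp [unusedT]

lemma subtype_map_subtype {α : Type*} (p : α → Prop) [DecidablePred p]
    (O : Finset (Subtype p)) :
    (O.map (Function.Embedding.subtype p)).subtype p = O := by
  ext v
  simp [v.2]

/-- Two diagonally reduced contributors, of `G` and of `G.dual`, are dual when the heads of
each are the tails of the other and the reduced set of each is the unused set of the other. -/
structure IsDualPair (G : OHG V E I) (S : Finset V) (c : {v : V // v ∉ S} → I × I)
    (T : Finset E) (d : {e : E // e ∉ T} → I × I) : Prop where
  left : IsDiagRed G S c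
  right : IsDiagRed G.dual T d
  left_unused : T = unusedT G S c
  right_unused : S = unusedT G.dual T d
  left_head : ∀ v, ∃ e, (d e).1 = (c v).2
  right_head : ∀ e, ∃ v, (c v).1 = (d e).2

/-- The head permutation of a diagonally reduced contributor. -/
def headPerm {G : OHG V E I} {S : Finset V} {c : {v : V // v ∉ S} → I × I}
    (hc : IsDiagRed G S c) (v : {v : V // v ∉ S}) : {v : V // v ∉ S} :=
  ⟨G.vtx (c v).2, hc.2.2.1.mapsTo (Set.mem_univ v)⟩

lemma headPerm_injective {G : OHG V E I} {S : Finset V} {c : {v : V // v ∉ S} → I × I}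
    (hc : IsDiagRed G S c) : Function.Injective (headPerm hc) := fun v w h =>
  hc.2.2.1.injOn (Set.mem_univ v) (Set.mem_univ w) (congrArg Subtype.val h)

lemma headPerm_surjective {G : OHG V E I} {S : Finset V} {c : {v : V // v ∉ S} → I × I}
    (hc : IsDiagRed G S c) : Function.Surjective (headPerm hc) :=
  Finite.surjective_of_injective (headPerm_injective hc)

/-- The edge used at a vertex by a diagonally reduced contributor. -/
def usedEdge (G : OHG V E I) {S : Finset V} (c : {v : V // v ∉ S} → I × I)
    (v : {v : V // v ∉ S}) : {e : E // e ∉ unusedT G S c} :=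
  ⟨G.edg (c v).1, by simpa [unusedT] using ⟨v.1, v.2, rfl⟩⟩

lemma usedEdge_bijective {G : OHG V E I} {S : Finset V} {c : {v : V // v ∉ S} → I × I}
    (hc : IsDiagRed G S c) : Function.Bijective (usedEdge G c) := by
  refine ⟨fun v w h => hc.2.2.2 (congrArg Subtype.val h), fun ⟨e, he⟩ => ?_⟩
  obtain ⟨v, hv, h⟩ : ∃ v, ∃ hv : v ∉ S, G.edg (c ⟨v, hv⟩).1 = e := by
    simpa [unusedT] using he
  exact ⟨⟨v, hv⟩, Subtype.ext h⟩

/-- Every diagonally reduced contributor has a dual. -/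
lemma IsDiagRed.exists_isDualPair {G : OHG V E I} {S : Finset V}
    {c : {v : V // v ∉ S} → I × I} (hc : IsDiagRed G S c) :
    ∃ T d, IsDualPair G S c T d := by
  let φ := Equiv.ofBijective _ (usedEdge_bijective hc)
  have hφ : ∀ v, (φ v : E) = G.edg (c v).1 := fun v => rfl
  let d : {e : E // e ∉ unusedT G S c} → I × I := fun e =>
    ((c (φ.symm e)).2, (c (headPerm hc (φ.symm e))).1)
  have hd : ∀ v, d (φ v) = ((c v).2, (c (headPerm hc v)).1) := fun v => by simp [d]
  have hmaps : ∀ v, G.edg (d (φ v)).2 = φ (headPerm hc v) := fun v => by rw [hd]; rfl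
  refine ⟨unusedT G S c, d, hc, ⟨?_, ?_, ⟨?_, ?_, ?_⟩, ?_⟩, rfl, ?_, ?_, ?_⟩
  · refine φ.surjective.forall.2 fun v => ?_
    rw [hd, hφ]
    exact (hc.2.1 v).symm
  · refine φ.surjective.forall.2 fun v => ?_
    rw [hd]
    exact (hc.1 (headPerm hc v)).symm
  · refine fun e _ => ?_
    obtain ⟨v, rfl⟩ := φ.surjective e
    exact fun he => (φ (headPerm hc v)).2 (hmaps v ▸ he)
  · refine fun e _ e' _ h => ?_
    obtain ⟨v, rfl⟩ := φ.surjective e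
    obtain ⟨w, rfl⟩ := φ.surjective e'
    have h' : (φ (headPerm hc v) : E) = φ (headPerm hc w) := by
      rw [← hmaps, ← hmaps]; exact h
    rw [headPerm_injective hc (φ.injective (Subtype.ext h'))]
  · intro e he
    obtain ⟨w, hw⟩ := φ.surjective ⟨e, he⟩
    obtain ⟨v, rfl⟩ := headPerm_surjective hc w
    exact ⟨φ v, Set.mem_univ _, (hmaps v).trans (congrArg Subtype.val hw)⟩
  · intro e e' h
    obtain ⟨v, rfl⟩ := φ.surjective e
    obtain ⟨w, rfl⟩ := φ.surjective e'
    have h' : G.vtx (d (φ v)).1 = G.vtx (d (φ w)).1 := h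
    rw [hd, hd] at h'
    rw [headPerm_injective hc (Subtype.ext h')]
  · ext v
    rw [mem_unusedT]
    constructor
    · intro hv e he
      obtain ⟨w, rfl⟩ := φ.surjective e
      rw [hd] at he
      exact (headPerm hc w).2 (Set.mem_of_eq_of_mem (s := (S : Set V)) he hv)
    · intro h
      by_contra hv
      obtain ⟨w, hw⟩ := headPerm_surjective hc ⟨v, hv⟩
      refine h (φ w) ?_
      rw [hd]
      exact congrArg Subtype.val hw
  · exact fun v => ⟨φ v, by rw [hd]⟩
  · refine φ.surjective.forall.2 fun v => ⟨headPerm hc v, by rw [hd]⟩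

namespace IsDualPair

variable {G : OHG V E I} {S : Finset V} {c : {v : V // v ∉ S} → I × I}
  {T : Finset E} {d : {e : E // e ∉ T} → I × I}

lemma symm (h : IsDualPair G S c T d) : IsDualPair G.dual T d S c :=
  ⟨h.right, h.left, h.right_unused, h.left_unused, h.right_head, h.left_head⟩

/-- The bijection from the vertices of a contributor to those of its dual. -/
def edge (h : IsDualPair G S c T d) (v : {v : V // v ∉ S}) : {e : E // e ∉ T} :=
  ⟨G.edg (c v).1, h.left_unused ▸ (usedEdge G c v).2⟩

lemma edge_injective (h : IsDualPair G S c T d) : Function.Injective h.edge :=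
  fun _ _ hvw => h.left.2.2.2 (congrArg Subtype.val hvw)

lemma edge_surjective (h : IsDualPair G S c T d) : Function.Surjective h.edge := by
  have h' := h.left_unused
  subst h'
  exact (usedEdge_bijective h.left).2

lemma tail_edge (h : IsDualPair G S c T d) (v : {v : V // v ∉ S}) :
    (d (h.edge v)).1 = (c v).2 := by
  obtain ⟨e, he⟩ := h.left_head v
  have : e = h.edge v := Subtype.ext <| by
    rw [← h.right.1 e, he]
    exact (h.left.2.1 v).symm
  rw [← this, he]

lemma head_edge (h : IsDualPair G S c T d) (v : {v : V // v ∉ S}) :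
    (d (h.edge v)).2 = (c (headPerm h.left v)).1 := by
  obtain ⟨w, hw⟩ := h.right_head (h.edge v)
  have : w = headPerm h.left v := Subtype.ext <| by
    rw [← h.left.1 w, hw]
    refine (h.right.2.1 (h.edge v)).symm.trans ?_
    rw [h.tail_edge]
    rfl
  rw [← this, hw]

lemma semiconj_edge (h : IsDualPair G S c T d) :
    Function.Semiconj h.edge (headPerm h.left) (headPerm h.right) := fun v =>
  Subtype.ext (congrArg G.edg (h.head_edge v)).symm

/-- The dual of a contributor is unique. -/
lemma right_unique (h : IsDualPair G S c T d) {T' : Finset E}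
    {d' : {e : E // e ∉ T'} → I × I} (h' : IsDualPair G S c T' d') :
    (⟨T, d⟩ : Σ T : Finset E, {e : E // e ∉ T} → I × I) = ⟨T', d'⟩ := by
  obtain rfl : T = T' := h.left_unused.trans h'.left_unused.symm
  congr
  funext e
  obtain ⟨v, rfl⟩ := h.edge_surjective e
  exact Prod.ext ((h.tail_edge v).trans (h'.tail_edge v).symm)
    ((h.head_edge v).trans (h'.head_edge v).symm)

end IsDualPair

lemma mem_orbitOf {α : Type*} [Fintype α] [DecidableEq α] {f : α → α} {a b : α} :
    b ∈ orbitOf f a ↔ ∃ n : ℕ, f^[n] a = b := by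
  simp [orbitOf]

lemma map_orbitOf {α β : Type*} [Fintype α] [DecidableEq α] [Fintype β] [DecidableEq β]
    {f : α → α} {g : β → β} (φ : α ↪ β) (h : Function.Semiconj φ f g) (a : α) :
    (orbitOf f a).map φ = orbitOf g (φ a) := by
  ext b
  simp only [Finset.mem_map, mem_orbitOf]
  constructor
  · rintro ⟨_, ⟨n, rfl⟩, rfl⟩
    exact ⟨n, ((h.iterate_right n) a).symm⟩
  · rintro ⟨n, rfl⟩
    exact ⟨_, ⟨n, rfl⟩, (h.iterate_right n) a⟩

lemma self_mem_orbitOf {α : Type*} [Fintype α] [DecidableEq α] (f : α → α) (a : α) :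
    a ∈ orbitOf f a := mem_orbitOf.2 ⟨0, rfl⟩

lemma apply_mem_orbitOf {α : Type*} [Fintype α] [DecidableEq α] {f : α → α} {a b : α}
    (h : b ∈ orbitOf f a) : f b ∈ orbitOf f a := by
  obtain ⟨n, rfl⟩ := mem_orbitOf.1 h
  exact mem_orbitOf.2 ⟨n + 1, Function.iterate_succ_apply' f n a⟩

lemma orbitOf_eq_singleton {α : Type*} [Fintype α] [DecidableEq α] {f : α → α} {a : α}
    (h : f a = a) : orbitOf f a = {a} := by
  ext b
  simp [mem_orbitOf, Function.iterate_fixed h, eq_comm]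

lemma prod_orbitOf_comp {α M : Type*} [Fintype α] [DecidableEq α] [CommMonoid M]
    {f : α → α} (hf : Function.Injective f) (a : α) (w : α → M) :
    ∏ b ∈ orbitOf f a, w (f b) = ∏ b ∈ orbitOf f a, w b := by
  have h : (orbitOf f a).map ⟨f, hf⟩ = orbitOf f a :=
    Finset.eq_of_subset_of_card_le
      (Finset.map_subset_iff_subset_preimage.2 fun b hb =>
        Finset.mem_preimage.2 (apply_mem_orbitOf hb))
      (Finset.card_map _).ge
  conv_rhs => rw [← h, Finset.prod_map]
  rfl

section Orbits

variable {G : OHG V E I} {S : Finset V} {c : {v : V // v ∉ S} → I × I}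

lemma semiconj_val_gmapD (hc : IsDiagRed G S c) :
    Function.Semiconj (Function.Embedding.subtype (· ∉ S)) (headPerm hc) (gmapD G S c) :=
  fun v => by simp [gmapD, headPerm, v.2]

lemma orbitOf_gmapD (hc : IsDiagRed G S c) (v : {v : V // v ∉ S}) :
    orbitOf (gmapD G S c) v =
      (orbitOf (headPerm hc) v).map (Function.Embedding.subtype (· ∉ S)) :=
  (map_orbitOf _ (semiconj_val_gmapD hc) v).symm

lemma orbitOf_gmapD_of_mem {v : V} (hv : v ∈ S) : orbitOf (gmapD G S c) v = {v} :=
  orbitOf_eq_singleton (by simp [gmapD, hv])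

lemma not_negOrbitD_singleton {v : V} (hv : v ∈ S) : ¬ NegOrbitD G S c {v} := by
  rintro ⟨-, h⟩
  rw [Finset.prod_eq_one] at h
  · exact absurd h (by decide)
  · intro w hw
    simp only [Finset.mem_filter, Finset.mem_singleton] at hw
    exact absurd (hw.2 ▸ hv) w.2

lemma negOrbitD_map_iff (O : Finset {v : V // v ∉ S}) :
    NegOrbitD G S c (O.map (Function.Embedding.subtype (· ∉ S))) ↔
      (¬ ∃ v, O = {v} ∧ (c v).1 = (c v).2) ∧
        ∏ v ∈ O, (-(G.sgn (c v).1 * G.sgn (c v).2)) = (-1 : ℤˣ) := by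
  have h₁ : Finset.univ.filter (fun v : {v : V // v ∉ S} =>
      v.1 ∈ O.map (Function.Embedding.subtype (· ∉ S))) = O := by
    ext v
    simpa using fun _ => v.2
  have h₂ : ∀ v : {v : V // v ∉ S},
      O.map (Function.Embedding.subtype (· ∉ S)) = {v.1} ↔ O = {v} := fun v => by
    rw [← Finset.map_inj (f := Function.Embedding.subtype (· ∉ S)), Finset.map_singleton]
    rfl
  simp only [NegOrbitD, h₁, h₂]

end Orbits

namespace IsDualPair

variable {G : OHG V E I} {S : Finset V} {c : {v : V // v ∉ S} → I × I}
  {T : Finset E} {d : {e : E // e ∉ T} → I × I}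

/-- Orbits with a property that no singleton of a reduced vertex has are carried
injectively to orbits of the dual contributor. -/
lemma card_orbits_le (h : IsDualPair G S c T d) (P : Finset V → Prop) (Q : Finset E → Prop)
    [DecidablePred P] [DecidablePred Q]
    (hP : ∀ v ∈ S, ¬ P {v})
    (hPQ : ∀ v, P ((orbitOf (headPerm h.left) v).map (Function.Embedding.subtype (· ∉ S))) →
      Q (((orbitOf (headPerm h.left) v).map ⟨h.edge, h.edge_injective⟩).map
        (Function.Embedding.subtype (· ∉ T)))) :
    ((orbitsOf (gmapD G S c)).filter P).card ≤
      ((orbitsOf (gmapD G.dual T d)).filter Q).card := by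
  have key : ∀ O ∈ (orbitsOf (gmapD G S c)).filter P, ∃ v,
      O = (orbitOf (headPerm h.left) v).map (Function.Embedding.subtype (· ∉ S)) := by
    intro O hO
    obtain ⟨hO, hPO⟩ := Finset.mem_filter.1 hO
    obtain ⟨v, -, rfl⟩ := Finset.mem_image.1 hO
    by_cases hv : v ∈ S
    · exact absurd (orbitOf_gmapD_of_mem (G := G) (c := c) hv ▸ hPO) (hP v hv)
    · exact ⟨⟨v, hv⟩, orbitOf_gmapD h.left ⟨v, hv⟩⟩
  refine Finset.card_le_card_of_injOn
    (fun O => ((O.subtype (· ∉ S)).map ⟨h.edge, h.edge_injective⟩).map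
      (Function.Embedding.subtype (· ∉ T))) ?_ ?_
  · intro O hO
    obtain ⟨v, rfl⟩ := key O hO
    have hPO := (Finset.mem_filter.1 hO).2
    simp only [subtype_map_subtype]
    refine Finset.mem_filter.2 ⟨Finset.mem_image.2 ⟨h.edge v, Finset.mem_univ _, ?_⟩, hPQ v hPO⟩
    rw [orbitOf_gmapD h.right, map_orbitOf ⟨h.edge, h.edge_injective⟩ h.semiconj_edge]
    rfl
  · intro O hO O' hO' heq
    obtain ⟨v, rfl⟩ := key O hO
    obtain ⟨w, rfl⟩ := key O' hO'
    simpa [subtype_map_subtype] using heq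

lemma ecD_le (h : IsDualPair G S c T d) : ecD G S c ≤ ecD G.dual T d :=
  h.card_orbits_le (fun O => Even O.card) (fun O => Even O.card) (fun v _ => by simp)
    fun v hv => by simpa using hv

lemma ncD_le (h : IsDualPair G S c T d) : ncD G S c ≤ ncD G.dual T d := by
  refine h.card_orbits_le _ _ (fun v hv => not_negOrbitD_singleton hv) fun v hv => ?_
  rw [negOrbitD_map_iff] at hv ⊢
  refine ⟨?_, ?_⟩
  · rintro ⟨e, he, hback⟩
    obtain ⟨w, rfl⟩ := h.edge_surjective e
    have hw : orbitOf (headPerm h.left) v = {w} :=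
      Finset.map_injective ⟨h.edge, h.edge_injective⟩
        (he.trans (Finset.map_singleton ⟨h.edge, h.edge_injective⟩ w).symm)
    have hfix : headPerm h.left w = w := Finset.mem_singleton.1 <| hw ▸
      apply_mem_orbitOf (hw ▸ Finset.mem_singleton_self w)
    refine hv.1 ⟨w, hw, ?_⟩
    rw [h.tail_edge, h.head_edge, hfix] at hback
    exact hback.symm
  · rw [Finset.prod_map, ← hv.2, Finset.prod_neg, Finset.prod_neg]
    congr 1
    have : ∀ w, G.dual.sgn (d (h.edge w)).1 * G.dual.sgn (d (h.edge w)).2 =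
        G.sgn (c w).2 * G.sgn (c (headPerm h.left w)).1 := fun w => by
      rw [h.tail_edge, h.head_edge]
      rfl
    simp only [Function.Embedding.coeFn_mk, this, Finset.prod_mul_distrib]
    rw [prod_orbitOf_comp (headPerm_injective h.left) v fun w => G.sgn (c w).1, mul_comm]

lemma bsD_le (h : IsDualPair G S c T d) : bsD G S c ≤ bsD G.dual T d := by
  refine Finset.card_le_card_of_injOn h.edge (fun v hv => ?_) h.edge_injective.injOn
  simp only [Finset.coe_filter, Finset.mem_univ, true_and, Set.mem_ofPred_eq] at hv ⊢
  have hfix : headPerm h.left v = v := Subtype.ext <|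
    (congrArg G.vtx hv).symm.trans (h.left.1 v)
  rw [h.tail_edge, h.head_edge, hfix, hv]

lemma csgnD_eq (h : IsDualPair G S c T d) : csgnD G S c = csgnD G.dual T d := by
  unfold csgnD
  rw [h.ecD_le.antisymm h.symm.ecD_le, h.ncD_le.antisymm h.symm.ncD_le,
    h.bsD_le.antisymm h.symm.bsD_le]

end IsDualPair

/-- In `ℤ[x_v, y_e : v ∈ V, e ∈ E]` the extended characteristic
polynomial of `G` equals that of its incidence dual `G*`:
`Σ_{(S,c)} csgn c · Π_{v∈S} x_v · Π_{e∈T(c)} y_e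
  = Σ_{(S*,c*)} csgn c* · Π_{e∈S*} y_e · Π_{v∈T(c*)} x_v`,
the sums running over all diagonally reduced contributors of `G` and of `G*`,
respectively, each with its unused set. -/
theorem extended_charpoly_dual (G : OHG V E I) :
    (∑ S : Finset V,
        ∑ c ∈ Finset.univ.filter
            (fun c : {v : V // v ∉ S} → I × I => IsDiagRed G S c),
          MvPolynomial.C (csgnD G S c) *
            ((∏ v ∈ S, (MvPolynomial.X (Sum.inl v) : MvPolynomial (V ⊕ E) ℤ)) *
              ∏ e ∈ unusedT G S c, MvPolynomial.X (Sum.inr e)))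
      = ∑ T : Finset E,
          ∑ c ∈ Finset.univ.filter
              (fun c : {e : E // e ∉ T} → I × I => IsDiagRed G.dual T c),
            MvPolynomial.C (csgnD G.dual T c) *
              ((∏ e ∈ T, (MvPolynomial.X (Sum.inr e) : MvPolynomial (V ⊕ E) ℤ)) *
                ∏ v ∈ unusedT G.dual T c, MvPolynomial.X (Sum.inl v)) := by
  rw [Finset.sum_sigma', Finset.sum_sigma']
  choose T d hd using fun (S : Finset V) (c : {v : V // v ∉ S} → I × I)
    (hc : IsDiagRed G S c) => hc.exists_isDualPair
  have red : ∀ x ∈ (Finset.univ : Finset (Finset V)).sigma fun S =>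
      Finset.univ.filter fun c : {v : V // v ∉ S} → I × I => IsDiagRed G S c,
      IsDiagRed G x.1 x.2 := fun x hx => by simpa using hx
  refine Finset.sum_bij (fun x hx => ⟨T x.1 x.2 (red x hx), d x.1 x.2 (red x hx)⟩)
    ?_ ?_ ?_ ?_
  · exact fun x hx => by simpa using (hd x.1 x.2 (red x hx)).right
  · rintro ⟨S, c⟩ hx ⟨S', c'⟩ hx' heq
    have h := (hd S c (red _ hx)).symm
    have h' := (hd S' c' (red _ hx')).symm
    obtain ⟨hT, hdd⟩ := Sigma.mk.inj heq
    revert h h'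
    generalize d S c _ = e at hdd ⊢
    generalize d S' c' _ = e' at hdd ⊢
    revert e e'
    generalize T S c _ = U at hT ⊢
    generalize T S' c' _ = U' at hT ⊢
    subst hT
    rintro e e' hee h h'
    obtain rfl := eq_of_heq hee
    exact h.right_unique h'
  · rintro ⟨U, e⟩ hy
    have he : IsDiagRed G.dual U e := by simpa using hy
    obtain ⟨S, c, h⟩ := he.exists_isDualPair
    have hx : IsDiagRed G S c := h.right
    exact ⟨⟨S, c⟩, by simpa using hx, (hd S c hx).right_unique h.symm⟩
  · intro x hx
    have h := hd x.1 x.2 (red x hx)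
    rw [h.csgnD_eq, ← h.left_unused, ← h.right_unused, mul_comm (∏ v ∈ x.1, _)]
end
end

section
/- Let G be an oriented hypergraph with incidence matrix H and Laplacian L = H·Hᵀ. Then the traditional characteristic polynomial of L satisfies det(x·I − L) = Σ_{(S,c)} csgn(c) · x^{|S|} in ℤ[x], where the sum runs over all diagonally reduced contributors (S,c) of G. -/
open Matrix
open scoped Classical

noncomputable section

section Helpers

/-- Expansion of the characteristic polynomial along principal minors of `-M`. -/
lemma charpoly_eq_sum_principal_minors {n R : Type*} [Fintype n] [DecidableEq n] [CommRing R]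
    (M : Matrix n n R) :
    M.charpoly = ∑ S : Finset n,
      Polynomial.C (Matrix.det (Matrix.of fun v w : {v : n // v ∉ S} => -M v w)) *
        Polynomial.X ^ S.card := by
  have hsplit : M.charmatrix = (fun i j => if i = j then (Polynomial.X : Polynomial R) else 0) +
      (fun i j => Polynomial.C (-M i j)) := by
    ext1 i j
    change M.charmatrix i j = (if i = j then _ else _) + Polynomial.C (-M i j)
    rw [Matrix.charmatrix_apply, Matrix.diagonal_apply, map_neg, sub_eq_add_neg]
  have hadd := (Matrix.detRowAlternating (n := n) (R := Polynomial R)).map_add_univ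
    (fun i j => if i = j then (Polynomial.X : Polynomial R) else 0)
    (fun i j => Polynomial.C (-M i j))
  rw [Matrix.charpoly, hsplit]
  refine hadd.trans (Finset.sum_congr rfl fun S _ => ?_)
  change Matrix.det (Matrix.of (S.piecewise
    (fun i j => if i = j then (Polynomial.X : Polynomial R) else 0)
    (fun i j => Polynomial.C (-M i j)))) = _
  rw [Matrix.twoBlockTriangular_det _ (· ∉ S)]
  · congr 1
    · rw [RingHom.map_det]
      congr 1
      ext1 v w
      simp [Matrix.toSquareBlockProp, Finset.piecewise, v.2]
    · have hdiag : Matrix.toSquareBlockProp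
          (Matrix.of (S.piecewise (fun i j => if i = j then (Polynomial.X : Polynomial R) else 0)
            (fun i j => Polynomial.C (-M i j)))) (fun v => ¬ v ∉ S) =
          Matrix.diagonal fun _ => Polynomial.X := by
        ext1 v w
        rw [Matrix.toSquareBlockProp_def, Matrix.of_apply, Matrix.of_apply,
          Finset.piecewise_eq_of_mem _ _ _ (not_not.1 v.2),
          Matrix.diagonal_apply]
        exact if_congr Subtype.ext_iff.symm rfl rfl
      rw [hdiag, Matrix.det_diagonal, Finset.prod_const, Finset.card_univ, Fintype.card_subtype]
      simp
  · intro i hi j hj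
    have hij : i ≠ j := fun h => hi (h ▸ hj)
    simp [Finset.piecewise, not_not.1 hi, hij]

/-- Expansion of `det (-A Aᵀ)` over injective column choices. -/
lemma det_neg_mul_transpose_expand {W E R : Type*} [Fintype W] [DecidableEq W] [Fintype E]
    [CommRing R] (A : W → E → R) :
    Matrix.det (Matrix.of fun v w : W => -∑ e, A v e * A w e) =
      ∑ p : W → E, ∑ π : Equiv.Perm W, if Function.Injective p then
        ((Equiv.Perm.sign π : ℤ) : R) * ∏ v, -(A v (p v) * A (π v) (p v)) else 0 := by
  rw [Matrix.det_apply']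
  simp only [Matrix.of_apply, ← Finset.sum_neg_distrib, Finset.prod_univ_sum,
    Fintype.piFinset_univ, Finset.mul_sum]
  rw [Finset.sum_comm]
  refine Finset.sum_congr rfl fun p _ => ?_
  by_cases hp : Function.Injective p
  · simp only [hp, if_true]
    refine Finset.sum_congr rfl fun π _ => ?_
    congr 1
    exact Finset.prod_congr rfl fun v _ => by rw [mul_comm]
  · simp only [hp, if_false, Finset.sum_const_zero]
    obtain ⟨i, j, hij, hne⟩ : ∃ i j, p i = p j ∧ i ≠ j := by
      simpa [Function.Injective] using hp
    have hdet : Matrix.det (Matrix.of fun v w : W => A v (p w)) = 0 :=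
      Matrix.det_zero_of_column_eq hne fun k => by simp [hij]
    rw [Matrix.det_apply'] at hdet
    calc _ = (∏ v, -A v (p v)) * ∑ π : Equiv.Perm W,
          ((Equiv.Perm.sign π : ℤ) : R) * ∏ v, A (π v) (p v) := by
          rw [Finset.mul_sum]
          refine Finset.sum_congr rfl fun π _ => ?_
          rw [mul_left_comm, ← Finset.prod_mul_distrib]
          congr 1
          exact Finset.prod_congr rfl fun v _ => by ring
      _ = 0 := by
          simp only [Matrix.of_apply] at hdet
          rw [hdet, mul_zero]

section Orbits

variable {α : Type*} [Fintype α] [DecidableEq α]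

lemma mem_orbitOf_perm (σ : Equiv.Perm α) (a b : α) : b ∈ orbitOf σ a ↔ σ.SameCycle a b := by
  simp only [orbitOf, Finset.mem_filter, Finset.mem_univ, true_and]
  constructor
  · rintro ⟨n, rfl⟩
    exact ⟨n, by simp [Equiv.Perm.iterate_eq_pow]⟩
  · intro h
    obtain ⟨n, hn⟩ := h.exists_nat_pow_eq
    exact ⟨n, by rw [Equiv.Perm.iterate_eq_pow, hn]⟩

lemma orbitOf_perm_eq_iff (σ : Equiv.Perm α) (a b : α) :
    orbitOf σ a = orbitOf σ b ↔ σ.SameCycle b a := by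
  constructor
  · intro h
    rw [← mem_orbitOf_perm, ← h, mem_orbitOf_perm]
  · intro h
    ext x
    rw [mem_orbitOf_perm, mem_orbitOf_perm]
    exact ⟨h.trans, h.symm.trans⟩

lemma prod_orbitsOf {M : Type*} [CommMonoid M] (σ : Equiv.Perm α) (g : α → M) :
    ∏ O ∈ orbitsOf σ, ∏ v ∈ O, g v = ∏ v, g v := by
  rw [← Finset.prod_fiberwise_of_maps_to (s := Finset.univ) (t := orbitsOf σ) (g := orbitOf σ)
    (fun v _ => Finset.mem_image_of_mem _ (Finset.mem_univ v))]
  refine Finset.prod_congr rfl fun O hO => Finset.prod_congr ?_ fun _ _ => rfl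
  obtain ⟨a, -, rfl⟩ := Finset.mem_image.1 hO
  ext x
  simp [mem_orbitOf_perm, orbitOf_perm_eq_iff]

lemma orbitOf_eq_support_cycleOf (σ : Equiv.Perm α) {a : α} (ha : a ∈ σ.support) :
    orbitOf σ a = (σ.cycleOf a).support := by
  ext x
  rw [mem_orbitOf_perm, Equiv.Perm.mem_support_cycleOf_iff]
  simp [Equiv.Perm.mem_support.1 ha]

lemma orbitOf_eq_singleton_s17 (σ : Equiv.Perm α) {a : α} (ha : σ a = a) : orbitOf σ a = {a} := by
  ext x
  rw [mem_orbitOf_perm, Finset.mem_singleton]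
  exact ⟨fun h => (h.eq_of_left ha).symm, fun h => h ▸ Equiv.Perm.SameCycle.refl σ a⟩

/-- The sign of a permutation is `(-1)` to the number of orbits of even cardinality. -/
lemma sign_eq_neg_one_pow_even_orbits (σ : Equiv.Perm α) :
    Equiv.Perm.sign σ = (-1) ^ ((orbitsOf σ).filter fun O => Even O.card).card := by
  rw [Equiv.Perm.sign_of_cycleType', Equiv.Perm.cycleType_def, Multiset.map_map,
    Finset.card_filter, ← Finset.prod_pow_eq_pow_sum]
  change ∏ c ∈ σ.cycleFactorsFinset, -(-1 : ℤˣ) ^ c.support.card = _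
  have hsub : σ.cycleFactorsFinset.image Equiv.Perm.support ⊆ orbitsOf σ := by
    intro O hO
    obtain ⟨c, hc, rfl⟩ := Finset.mem_image.1 hO
    obtain ⟨a, ha⟩ := (Equiv.Perm.mem_cycleFactorsFinset_iff.1 hc).1.nonempty_support
    refine Finset.mem_image.2 ⟨a, Finset.mem_univ _, ?_⟩
    rw [orbitOf_eq_support_cycleOf σ (Equiv.Perm.mem_cycleFactorsFinset_support_le hc ha),
      ← Equiv.Perm.cycle_is_cycleOf ha hc]
  rw [← Finset.prod_subset hsub, Finset.prod_image]
  · refine Finset.prod_congr rfl fun c _ => ?_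
    rcases Nat.even_or_odd c.support.card with h | h
    · simp [h]
    · simp [h, Nat.not_even_iff_odd.2 h]
  · intro c hc d hd hcd
    obtain ⟨a, ha⟩ := (Equiv.Perm.mem_cycleFactorsFinset_iff.1 hc).1.nonempty_support
    have hcd' : c.support = d.support := hcd
    rw [Equiv.Perm.cycle_is_cycleOf ha hc, Equiv.Perm.cycle_is_cycleOf (hcd' ▸ ha) hd]
  · intro O hO hO'
    obtain ⟨a, -, rfl⟩ := Finset.mem_image.1 hO
    have ha : σ a = a := by
      by_contra ha
      refine hO' (Finset.mem_image.2 ⟨σ.cycleOf a, ?_, ?_⟩)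
      · exact Equiv.Perm.cycleOf_mem_cycleFactorsFinset_iff.2 (Equiv.Perm.mem_support.2 ha)
      · rw [orbitOf_eq_support_cycleOf σ (Equiv.Perm.mem_support.2 ha)]
    simp [orbitOf_eq_singleton_s17 σ ha]

end Orbits

variable {V E I : Type*}

lemma prod_adjacency_signs_eq [Fintype V] [DecidableEq V] [DecidableEq I]
    (G : OHG V E I) (S : Finset V) (c : {v : V // v ∉ S} → I × I)
    (σ : Equiv.Perm V) (hσ : gmapD G S c = σ) (htail : ∀ v, G.vtx (c v).1 = v.1) :
    ∏ v, (-(G.sgn (c v).1 * G.sgn (c v).2)) = (-1) ^ (ncD G S c + bsD G S c) := by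
  have hfix : ∀ v : {v : V // v ∉ S}, (c v).1 = (c v).2 → orbitOf σ v.1 = {v.1} := by
    intro v hv
    refine orbitOf_eq_singleton_s17 σ ?_
    rw [← hσ, gmapD, dif_neg v.2, ← hv, htail]
  have hbs : bsD G S c = ((orbitsOf σ).filter fun O =>
      ∃ v : {v : V // v ∉ S}, O = {v.1} ∧ (c v).1 = (c v).2).card := by
    refine Finset.card_bij (fun v _ => {v.1}) ?_ ?_ ?_
    · intro v hv
      have hv' := (Finset.mem_filter.1 hv).2
      refine Finset.mem_filter.2 ⟨?_, v, rfl, hv'⟩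
      rw [← hfix v hv']
      exact Finset.mem_image_of_mem _ (Finset.mem_univ _)
    · intro v _ w _ h
      exact Subtype.ext (Finset.singleton_injective h)
    · intro O hO
      obtain ⟨v, rfl, hv⟩ := (Finset.mem_filter.1 hO).2
      exact ⟨v, by simp [hv], rfl⟩
  have hsub : ∀ O : Finset V, ∏ v ∈ O, (if h : v ∈ S then (1 : ℤˣ) else
      -(G.sgn (c ⟨v, h⟩).1 * G.sgn (c ⟨v, h⟩).2)) =
      ∏ v ∈ Finset.univ.filter (fun v : {v : V // v ∉ S} => v.1 ∈ O),
        (-(G.sgn (c v).1 * G.sgn (c v).2)) := by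
    intro O
    symm
    refine Finset.prod_bij_ne_one (fun v _ _ => v.1) ?_ ?_ ?_ ?_
    · intro v hv _
      exact (Finset.mem_filter.1 hv).2
    · intro v _ _ w _ _ h
      exact Subtype.ext h
    · intro v hv h1
      have hvS : v ∉ S := fun h => h1 (by simp [h])
      rw [dif_neg hvS] at h1
      exact ⟨⟨v, hvS⟩, by simpa using hv, h1, rfl⟩
    · intro v _ _
      rw [dif_neg v.2]
  have huniv := hsub Finset.univ
  simp only [Finset.mem_univ, Finset.filter_true] at huniv
  rw [← huniv, ← prod_orbitsOf σ, pow_add, hbs, ncD, hσ, Finset.card_filter, Finset.card_filter,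
    ← Finset.prod_pow_eq_pow_sum, ← Finset.prod_pow_eq_pow_sum, ← Finset.prod_mul_distrib]
  refine Finset.prod_congr rfl fun O _ => ?_
  rw [hsub O]
  by_cases hO : ∃ v : {v : V // v ∉ S}, O = {v.1} ∧ (c v).1 = (c v).2
  · have hneg : ¬ NegOrbitD G S c O := fun h => h.1 hO
    rw [if_neg hneg, if_pos hO]
    obtain ⟨v, rfl, hv⟩ := hO
    have hfilter : Finset.univ.filter (fun w : {v : V // v ∉ S} => w.1 ∈ ({v.1} : Finset V)) =
        {v} := by
      ext w
      simp [Subtype.ext_iff]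
    rw [hfilter, Finset.prod_singleton, hv, Int.units_mul_self]
    simp
  · rw [if_neg hO, pow_zero, mul_one]
    by_cases hneg : NegOrbitD G S c O
    · rw [if_pos hneg, hneg.2, pow_one]
    · rw [if_neg hneg, pow_zero]
      exact (Int.units_eq_one_or _).resolve_right fun h => hneg ⟨hO, h⟩

lemma csgnD_eq_sign_mul_prod [Fintype V] [DecidableEq V] [DecidableEq I]
    (G : OHG V E I) (S : Finset V) (c : {v : V // v ∉ S} → I × I)
    (π : Equiv.Perm {v : V // v ∉ S}) (hhead : ∀ v, G.vtx (c v).2 = (π v).1)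
    (htail : ∀ v, G.vtx (c v).1 = v.1) :
    csgnD G S c = (Equiv.Perm.sign π : ℤ) *
      ∏ v, (-((G.sgn (c v).1 : ℤ) * (G.sgn (c v).2 : ℤ))) := by
  have hσ : gmapD G S c = Equiv.Perm.ofSubtype π := by
    ext v
    by_cases hv : v ∈ S
    · rw [gmapD, dif_pos hv, Equiv.Perm.ofSubtype_apply_of_not_mem (p := (· ∉ S)) _ (not_not.2 hv)]
    · rw [gmapD, dif_neg hv, Equiv.Perm.ofSubtype_apply_of_mem (p := (· ∉ S)) _ hv, hhead]
  have hsign : Equiv.Perm.sign π = (-1) ^ ecD G S c := by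
    rw [ecD, hσ, ← sign_eq_neg_one_pow_even_orbits, Equiv.Perm.sign_ofSubtype]
  have hprod := congrArg (Units.val : ℤˣ → ℤ) (prod_adjacency_signs_eq G S c _ hσ htail)
  push_cast at hprod
  rw [hprod, hsign, csgnD, add_assoc, pow_add]
  push_cast
  rfl

/-- The incidence pair `x = (t, h)` is an adjacency from `v` to `w` through `e`. -/
def IsAdjacency (G : OHG V E I) (v w : V) (e : E) (x : I × I) : Prop :=
  (G.vtx x.1 = v ∧ G.edg x.1 = e) ∧ (G.vtx x.2 = w ∧ G.edg x.2 = e)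

lemma incM_mul_incM [DecidableEq V] [DecidableEq E] [Fintype I]
    (G : OHG V E I) (v w : V) (e : E) :
    -(incM G v e * incM G w e) = ∑ x : I × I,
      if IsAdjacency G v w e x then -((G.sgn x.1 : ℤ) * (G.sgn x.2 : ℤ)) else 0 := by
  simp only [incM, Matrix.of_apply, Finset.sum_filter, Finset.sum_mul_sum, Fintype.sum_prod_type,
    ← Finset.sum_neg_distrib]
  refine Finset.sum_congr rfl fun t _ => Finset.sum_congr rfl fun h _ => ?_
  unfold IsAdjacency
  by_cases h1 : G.vtx t = v ∧ G.edg t = e <;> by_cases h2 : G.vtx h = w ∧ G.edg h = e <;>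
    simp [h1, h2]

lemma isDiagRed_of_isAdjacency (G : OHG V E I) {S : Finset V} {c : {v : V // v ∉ S} → I × I}
    {p : {v : V // v ∉ S} → E} {π : Equiv.Perm {v : V // v ∉ S}} (hp : Function.Injective p)
    (h : ∀ v, IsAdjacency G v.1 (π v).1 (p v) (c v)) : IsDiagRed G S c := by
  refine ⟨fun v => (h v).1.1, fun v => (h v).1.2.trans (h v).2.2.symm, ⟨?_, ?_, ?_⟩, ?_⟩
  · intro v _
    change G.vtx (c v).2 ∉ S
    rw [(h v).2.1]
    exact (π v).2
  · intro v _ w _ hvw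
    have hvw' : G.vtx (c v).2 = G.vtx (c w).2 := hvw
    rw [(h v).2.1, (h w).2.1] at hvw'
    exact π.injective (Subtype.ext hvw')
  · intro w hw
    refine ⟨π.symm ⟨w, hw⟩, Set.mem_univ _, ?_⟩
    change G.vtx (c _).2 = w
    rw [(h _).2.1, Equiv.apply_symm_apply]
  · intro v w hvw
    have hvw' : G.edg (c v).1 = G.edg (c w).1 := hvw
    rw [(h v).1.2, (h w).1.2] at hvw'
    exact hp hvw'

lemma exists_isAdjacency_of_isDiagRed [Fintype V]
    (G : OHG V E I) {S : Finset V}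
    {c : {v : V // v ∉ S} → I × I} (h : IsDiagRed G S c) :
    ∃ (p : {v : V // v ∉ S} → E) (π : Equiv.Perm {v : V // v ∉ S}),
      Function.Injective p ∧ ∀ v, IsAdjacency G v.1 (π v).1 (p v) (c v) := by
  obtain ⟨htail, hedge, hbij, hinj⟩ := h
  have hπ : Function.Injective fun v : {v : V // v ∉ S} =>
      (⟨G.vtx (c v).2, hbij.mapsTo (Set.mem_univ v)⟩ : {v : V // v ∉ S}) := by
    intro v w hvw
    exact hbij.injOn (Set.mem_univ v) (Set.mem_univ w) (congrArg Subtype.val hvw)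
  exact ⟨fun v => G.edg (c v).1, Equiv.ofBijective _ (Finite.injective_iff_bijective.1 hπ), hinj,
    fun v => ⟨⟨htail v, rfl⟩, rfl, (hedge v).symm⟩⟩

lemma sum_contributor_weight [Fintype V] [DecidableEq V] [Fintype E] [DecidableEq E]
    [DecidableEq I] (G : OHG V E I) (S : Finset V) (c : {v : V // v ∉ S} → I × I) :
    (∑ p : {v : V // v ∉ S} → E, ∑ π : Equiv.Perm {v : V // v ∉ S},
      if Function.Injective p ∧ ∀ v, IsAdjacency G v.1 (π v).1 (p v) (c v) then
        (Equiv.Perm.sign π : ℤ) * ∏ v, (-((G.sgn (c v).1 : ℤ) * (G.sgn (c v).2 : ℤ))) else 0) =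
      if IsDiagRed G S c then csgnD G S c else 0 := by
  by_cases hc : IsDiagRed G S c
  · rw [if_pos hc]
    obtain ⟨p₀, π₀, hp₀, h₀⟩ := exists_isAdjacency_of_isDiagRed G hc
    rw [Finset.sum_eq_single p₀, Finset.sum_eq_single π₀, if_pos ⟨hp₀, h₀⟩]
    · exact (csgnD_eq_sign_mul_prod G S c π₀ (fun v => (h₀ v).2.1) fun v => (h₀ v).1.1).symm
    · intro π _ hπ
      refine if_neg fun h => hπ (Equiv.ext fun v => Subtype.ext ?_)
      rw [← (h.2 v).2.1, (h₀ v).2.1]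
    · simp
    · intro p _ hp
      refine Finset.sum_eq_zero fun π _ => if_neg fun h => hp (funext fun v => ?_)
      rw [← (h.2 v).1.2, (h₀ v).1.2]
    · simp
  · rw [if_neg hc]
    exact Finset.sum_eq_zero fun p _ => Finset.sum_eq_zero fun π _ =>
      if_neg fun h => hc (isDiagRed_of_isAdjacency G h.1 h.2)

lemma det_neg_lapM_minor [Fintype V] [DecidableEq V] [Fintype E] [DecidableEq E]
    [Fintype I] [DecidableEq I] (G : OHG V E I) (S : Finset V) :
    Matrix.det (Matrix.of fun v w : {v : V // v ∉ S} => -lapM G v w) =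
      ∑ c ∈ Finset.univ.filter (fun c : {v : V // v ∉ S} → I × I => IsDiagRed G S c),
        csgnD G S c := by
  simp only [lapM, Matrix.mul_apply, Matrix.transpose_apply]
  rw [det_neg_mul_transpose_expand (fun (v : {v : V // v ∉ S}) e => incM G v.1 e),
    Finset.sum_filter]
  rw [Finset.sum_congr rfl fun c _ => (sum_contributor_weight G S c).symm]
  conv_rhs => rw [Finset.sum_comm]
  refine Finset.sum_congr rfl fun p _ => ?_
  conv_rhs => rw [Finset.sum_comm]
  refine Finset.sum_congr rfl fun π _ => ?_
  by_cases hp : Function.Injective p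
  · simp only [hp, if_true, true_and, incM_mul_incM, Finset.prod_univ_sum, Fintype.piFinset_univ,
      Finset.mul_sum, Int.cast_id]
    refine Finset.sum_congr rfl fun c _ => ?_
    rw [Finset.prod_ite_zero]
    simp
  · simp [hp]

end Helpers

variable {V E I : Type*} [Fintype V] [DecidableEq V] [Fintype E] [DecidableEq E]
  [Fintype I] [DecidableEq I]

/-- For an oriented hypergraph `G` with Laplacian `L = H Hᵀ`, the
traditional characteristic polynomial satisfies
`det (x·I − L) = Σ_{(S,c)} csgn c · x^{|S|}` in `ℤ[x]`, the sum running over all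
diagonally reduced contributors `(S, c)` of `G`. -/
theorem charpoly_lap_eq_sum_diagRed (G : OHG V E I) :
    (lapM G).charpoly
      = ∑ S : Finset V,
          ∑ c ∈ Finset.univ.filter
              (fun c : {v : V // v ∉ S} → I × I => IsDiagRed G S c),
            Polynomial.C (csgnD G S c) * Polynomial.X ^ S.card := by
  rw [charpoly_eq_sum_principal_minors]
  refine Finset.sum_congr rfl fun S _ => ?_
  rw [det_neg_lapM_minor, map_sum, Finset.sum_mul]
end
end
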